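/- arXiv:2403.02764 — 3 statements merged into one kernel-verified Lean document; each statement's English description precedes it below -/
import Mathlib

section
/- Let Ω ⊂ ℝ^d be compact and convex with non-empty interior, V a real finite-dimensional inner product space, and let μ, ν ∈ M(Ω;V) be finite V-valued measures with the same total mass (∫_Ω μ = ∫_Ω ν as elements of V). Then the supremum sup{ ∫_Ω ⟨φ, ν−μ⟩_V : φ ∈ C(Ω;V), |∇φ|_{V^d,∞} ≤ 1 } is attained by some φ ∈ Fr-Lip(Ω,V). -/
open MeasureTheory Set Filter
open scoped ENNReal RealInnerProductSpace Topology

noncomputable section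

/-- Euclidean space `ℝ^d`. -/
abbrev Euc (d : ℕ) := EuclideanSpace ℝ (Fin d)

variable {d : ℕ} {V : Type*} [NormedAddCommGroup V] [InnerProductSpace ℝ V]
  [FiniteDimensional ℝ V]

/-- Frobenius inner product on `V^d ≅ L(ℝ^d; V)`: `⟨A,B⟩ = Tr(Aᵀ B)`. -/
def frobInner (A B : Euc d →L[ℝ] V) : ℝ :=
  ∑ i, ⟪A (EuclideanSpace.single i 1), B (EuclideanSpace.single i 1)⟫

/-- Frobenius norm on `V^d ≅ L(ℝ^d; V)`. -/
def frobNorm (A : Euc d →L[ℝ] V) : ℝ :=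
  Real.sqrt (∑ i, ‖A (EuclideanSpace.single i 1)‖ ^ 2)

/-- Componentwise divergence of a (smooth) map `ψ : ℝ^d → V^d`. -/
def divg (ψ : Euc d → Euc d →L[ℝ] V) (x : Euc d) : V :=
  ∑ i, fderiv ℝ ψ x (EuclideanSpace.single i 1) (EuclideanSpace.single i 1)

/-- Test functions: smooth, compactly supported in the interior of `Ω`. -/
def IsTest (Ω : Set (Euc d)) (ψ : Euc d → Euc d →L[ℝ] V) : Prop :=
  ContDiff ℝ (⊤ : ℕ∞) ψ ∧ HasCompactSupport ψ ∧ tsupport ψ ⊆ interior Ω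

/-- `g` is the (componentwise) distributional gradient of `φ` on `Ω`:
for every test function `ψ`, `∫_Ω ⟨φ, div ψ⟩ = -∫_Ω ⟨g, ψ⟩_{V^d}`. -/
def IsDistribGrad (Ω : Set (Euc d)) (φ : Euc d → V)
    (g : Euc d → Euc d →L[ℝ] V) : Prop :=
  ∀ ψ : Euc d → Euc d →L[ℝ] V, IsTest Ω ψ →
    ∫ x in Ω, ⟪φ x, divg ψ x⟫ = - ∫ x in Ω, frobInner (g x) (ψ x)

/-- `φ ∈ C(Ω;V)` and its distributional gradient admits an `L^∞` representative
whose Frobenius norm is at most `c` almost everywhere on `Ω`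
(i.e. `|∇φ|_{V^d,∞} ≤ c`). -/
def FrLipOn (c : ℝ) (Ω : Set (Euc d)) (φ : Euc d → V) : Prop :=
  ContinuousOn φ Ω ∧ ∃ g : Euc d → Euc d →L[ℝ] V,
    AEStronglyMeasurable g (volume.restrict Ω) ∧
    (∀ᵐ x ∂(volume.restrict Ω), frobNorm (g x) ≤ c) ∧
    IsDistribGrad Ω φ g

/-- A finite `W`-valued measure on `Ω`, represented (by polar decomposition /
Radon–Nikodym) as a density `den` integrable against a positive measure `ρ`
concentrated on `Ω`. -/
structure VMeas (Ω : Set (Euc d)) (W : Type*) [NormedAddCommGroup W] where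
  ρ : Measure (Euc d)
  den : Euc d → W
  null_compl : ρ Ωᶜ = 0
  integrable : Integrable den ρ

namespace VMeas

variable {Ω : Set (Euc d)}

/-- Duality pairing `∫_Ω ⟨φ, μ⟩_V` of `μ ∈ M(Ω;V)` with `φ : Ω → V`. -/
def pair (μ : VMeas Ω V) (φ : Euc d → V) : ℝ :=
  ∫ x, ⟪φ x, μ.den x⟫ ∂μ.ρ

/-- Total variation norm `∫_Ω |μ|_V` of `μ ∈ M(Ω;V)`. -/
def tv (μ : VMeas Ω V) : ℝ := ∫ x, ‖μ.den x‖ ∂μ.ρ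

/-- Total mass `∫_Ω μ ∈ V` of `μ ∈ M(Ω;V)`. -/
def mass (μ : VMeas Ω V) : V := ∫ x, μ.den x ∂μ.ρ

/-- Frobenius duality pairing `∫_Ω ⟨ψ, σ⟩_{V^d}` of `σ ∈ M(Ω;V^d)` with
`ψ : Ω → V^d`. -/
def fpair (σ : VMeas Ω (Euc d →L[ℝ] V)) (ψ : Euc d → Euc d →L[ℝ] V) : ℝ :=
  ∫ x, frobInner (ψ x) (σ.den x) ∂σ.ρ

/-- Total variation norm `∫_Ω |σ|_{V^d}` of `σ ∈ M(Ω;V^d)` w.r.t. the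
Frobenius norm on `V^d`. -/
def ftv (σ : VMeas Ω (Euc d →L[ℝ] V)) : ℝ := ∫ x, frobNorm (σ.den x) ∂σ.ρ

end VMeas

/-- The divergence constraint `div σ = D` (with zero-flux boundary conditions),
in the weak sense: `-∫_Ω ⟨∇φ, σ⟩_{V^d} = D(φ)` for every `φ ∈ C¹(Ω;V)`.
Here `D` is the pairing functional of the prescribed right-hand side. -/
def DivEq {Ω : Set (Euc d)} (σ : VMeas Ω (Euc d →L[ℝ] V))
    (D : (Euc d → V) → ℝ) : Prop :=
  ∀ φ : Euc d → V, ContDiff ℝ 1 φ → -(σ.fpair fun x => fderiv ℝ φ x) = D φ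

/-- The (possibly infinite) value `sup { D(φ) : |∇φ|_{V^d,∞} ≤ 1 }`, used to
define `W₁^V` through the pairing functional `D` of `ν - μ`. -/
def W1fn (Ω : Set (Euc d)) (D : (Euc d → V) → ℝ) : ℝ≥0∞ :=
  ⨆ φ ∈ {φ : Euc d → V | FrLipOn 1 Ω φ}, ENNReal.ofReal (D φ)

set_option linter.unusedSectionVars false

lemma frob_apply_le (A : Euc d →L[ℝ] V) (h : Euc d) : ‖A h‖ ≤ frobNorm A * ‖h‖ := by
  have e : h = ∑ i, h i • EuclideanSpace.single i (1 : ℝ) := by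
    ext j
    simp [Finset.sum_apply, Pi.single_apply]
  have e2 : A h = ∑ i, h i • A (EuclideanSpace.single i (1 : ℝ)) := by
    conv_lhs => rw [e]
    simp only [map_sum, map_smul]
  rw [e2, EuclideanSpace.norm_eq, frobNorm]
  calc ‖∑ i, h i • A (EuclideanSpace.single i (1 : ℝ))‖
      ≤ ∑ i, ‖A (EuclideanSpace.single i (1 : ℝ))‖ * ‖h i‖ := by
        refine (norm_sum_le _ _).trans (Finset.sum_le_sum fun i _ => ?_)
        rw [norm_smul, mul_comm]
    _ ≤ _ := Real.sum_mul_le_sqrt_mul_sqrt _ _ _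

lemma sum_coord (L : Euc d →L[ℝ] ℝ) (h : Euc d) :
    ∑ i, L (EuclideanSpace.single i (1 : ℝ)) * h i = L h := by
  have e : h = ∑ i, h i • EuclideanSpace.single i (1 : ℝ) := by
    ext j
    simp [Finset.sum_apply, Pi.single_apply]
  conv_rhs => rw [e]
  simp only [map_sum, map_smul, smul_eq_mul, mul_comm]

lemma key_ibp {Ω : Set (Euc d)} {φ : Euc d → V} {g : Euc d → Euc d →L[ℝ] V}
    (hg : IsDistribGrad Ω φ g) (η : Euc d → ℝ) (hη : ContDiff ℝ (⊤ : ℕ∞) η) (z h : Euc d) (v : V)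
    {r : ℝ} (hr : tsupport η ⊆ Metric.closedBall 0 r) (hz : Metric.closedBall z r ⊆ interior Ω) :
    ∫ w in Ω, (fderiv ℝ η (z - w) h) * ⟪φ w, v⟫ = ∫ w in Ω, η (z - w) * ⟪g w h, v⟫ := by
  set B : Euc d →L[ℝ] V := (innerSL ℝ h).smulRight v with hB
  have hts : tsupport (fun w => η (z - w) • B) ⊆ Metric.closedBall z r := by
    refine closure_minimal ?_ Metric.isClosed_closedBall
    intro w hw
    have : η (z - w) ≠ 0 := by
      intro h0; simp [h0] at hw
    have := hr (subset_tsupport _ this)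
    simpa [dist_eq_norm, norm_sub_rev] using this
  have hsm : ContDiff ℝ (⊤ : ℕ∞) (fun w : Euc d => η (z - w)) :=
    hη.comp (contDiff_const.sub contDiff_id)
  have htest : IsTest Ω (fun w => η (z - w) • B) := by
    refine ⟨hsm.smul contDiff_const, ?_, hts.trans hz⟩
    exact (isCompact_closedBall z r).of_isClosed_subset (isClosed_tsupport _) hts
  have hd : ∀ w, divg (fun w => η (z - w) • B) w = -(fderiv ℝ η (z - w) h) • v := by
    intro w
    have h1 : HasFDerivAt η (fderiv ℝ η (z - w)) (z - w) :=
      (hη.differentiable (by simp) _).hasFDerivAt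
    have h2 : HasFDerivAt (fun w : Euc d => z - w) (-ContinuousLinearMap.id ℝ (Euc d)) w :=
      (hasFDerivAt_id w).const_sub z
    have h3 := (h1.comp w h2).smul_const B
    have h4 : fderiv ℝ (fun w => η (z - w) • B) w = _ := h3.fderiv
    rw [divg, h4, ← sum_coord (fderiv ℝ η (z - w)) h, ← Finset.sum_neg_distrib, Finset.sum_smul]
    refine Finset.sum_congr rfl fun i _ => ?_
    simp [hB, smul_smul, EuclideanSpace.inner_single_right]
  have hf : ∀ w, frobInner (g w) (η (z - w) • B) = η (z - w) * ⟪g w h, v⟫ := by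
    intro w
    have := sum_coord ((innerSL ℝ v).comp (g w)) h
    simp only [ContinuousLinearMap.comp_apply, innerSL_apply_apply] at this
    rw [real_inner_comm v, ← this, Finset.mul_sum, frobInner]
    refine Finset.sum_congr rfl fun i _ => ?_
    simp [hB, inner_smul_right, EuclideanSpace.inner_single_right, real_inner_comm]
    left
    ring
  have := hg _ htest
  simp only [hd, hf, inner_smul_right] at this
  simp only [neg_mul, integral_neg, neg_inj] at this
  exact this

lemma bump_lip {Ω : Set (Euc d)} (hΩ : IsCompact Ω) {φ : Euc d → V} (hφ : FrLipOn 1 Ω φ)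
    {x y : Euc d} {r : ℝ} (v : V)
    (hxy : ∀ z ∈ segment ℝ x y, Metric.closedBall z r ⊆ interior Ω)
    (η : ContDiffBump (0 : Euc d)) (hr : η.rOut ≤ r) :
    ‖(convolution (η.normed volume) (Ω.indicator fun w => ⟪φ w, v⟫) (ContinuousLinearMap.lsmul ℝ ℝ) volume) y -
     (convolution (η.normed volume) (Ω.indicator fun w => ⟪φ w, v⟫) (ContinuousLinearMap.lsmul ℝ ℝ) volume) x‖ ≤ ‖v‖ * ‖y - x‖ := by
  obtain ⟨hc, g, hgm, hgb, hg⟩ := hφ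
  have hint : Integrable (Ω.indicator fun w => ⟪φ w, v⟫) volume := by
    rw [integrable_indicator_iff hΩ.measurableSet]
    exact (hc.inner continuousOn_const).integrableOn_compact hΩ
  have hη : ContDiff ℝ (⊤ : ℕ∞) (η.normed volume) := η.contDiff_normed
  have hder := fun z => HasCompactSupport.hasFDerivAt_convolution_left
    (ContinuousLinearMap.lsmul ℝ ℝ) (η.hasCompactSupport_normed (μ := volume))
    (hη.of_le (by simp)) hint.locallyIntegrable z
  refine Convex.norm_image_sub_le_of_norm_hasFDerivWithin_le
    (fun z _ => (hder z).hasFDerivWithinAt) ?_ (convex_segment x y)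
    (left_mem_segment ℝ x y) (right_mem_segment ℝ x y)
  intro z hz
  refine ContinuousLinearMap.opNorm_le_bound _ (norm_nonneg _) fun h => ?_
  have hci : Integrable (fun w => (ContinuousLinearMap.precompL (Euc d) (ContinuousLinearMap.lsmul ℝ ℝ))
      (fderiv ℝ (η.normed volume) (z - w)) (Ω.indicator (fun w => ⟪φ w, v⟫) w)) := by
    have := ((η.hasCompactSupport_normed (μ := volume)).fderiv (𝕜 := ℝ)).convolutionExists_left
      (ContinuousLinearMap.precompL (Euc d) (ContinuousLinearMap.lsmul ℝ ℝ))
      (hη.continuous_fderiv (by simp)) hint.locallyIntegrable z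
    exact this.integrable_swap
  have e1 : (convolution (fderiv ℝ (η.normed volume)) (Ω.indicator fun w => ⟪φ w, v⟫)
      (ContinuousLinearMap.precompL (Euc d) (ContinuousLinearMap.lsmul ℝ ℝ)) volume) z h =
      ∫ w in Ω, (fderiv ℝ (η.normed volume) (z - w) h) * ⟪φ w, v⟫ := by
    rw [convolution_eq_swap, ContinuousLinearMap.integral_apply hci, ← integral_indicator hΩ.measurableSet]
    refine integral_congr_ae (Eventually.of_forall fun w => ?_)
    by_cases hw : w ∈ Ω <;> simp [hw, ContinuousLinearMap.precompL_apply]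
  rw [e1, key_ibp hg _ hη z h v (r := r) ?_ (hxy z hz)]
  · have hi : Integrable (fun w => η.normed volume (z - w) * (‖v‖ * ‖h‖)) volume :=
      (η.integrable_normed.comp_sub_left z).mul_const _
    calc ‖∫ w in Ω, η.normed volume (z - w) * ⟪g w h, v⟫‖
        ≤ ∫ w in Ω, η.normed volume (z - w) * (‖v‖ * ‖h‖) := by
          refine norm_integral_le_of_norm_le hi.integrableOn ?_
          filter_upwards [hgb] with w hw
          rw [norm_mul, Real.norm_of_nonneg (η.nonneg_normed _)]
          refine mul_le_mul_of_nonneg_left ?_ (η.nonneg_normed _)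
          refine (norm_inner_le_norm _ _).trans ?_
          rw [mul_comm]
          refine mul_le_mul_of_nonneg_left ?_ (norm_nonneg _)
          refine (frob_apply_le _ _).trans ?_
          exact mul_le_of_le_one_left (norm_nonneg _) hw
      _ ≤ ∫ w, η.normed volume (z - w) * (‖v‖ * ‖h‖) :=
          setIntegral_le_integral hi (Eventually.of_forall fun w =>
            mul_nonneg (η.nonneg_normed _) (by positivity))
      _ = ‖v‖ * ‖h‖ := by
          rw [integral_mul_const, integral_sub_left_eq_self (fun w => η.normed volume w) volume z,
            η.integral_normed, one_mul]
  · rw [η.tsupport_normed_eq]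
    exact Metric.closedBall_subset_closedBall hr

lemma frlip_lip {Ω : Set (Euc d)} (hΩ : IsCompact Ω) (hconv : Convex ℝ Ω)
    (hint : (interior Ω).Nonempty) {φ : Euc d → V} (hφ : FrLipOn 1 Ω φ) :
    LipschitzOnWith 1 φ Ω := by
  have hcl : closure (interior Ω) = Ω := by
    rw [Convex.closure_interior_eq_closure_of_nonempty_interior (𝕜 := ℝ) hconv hint, hΩ.isClosed.closure_eq]
  have main : LipschitzOnWith 1 φ (interior Ω) := by
    refine LipschitzOnWith.of_dist_le_mul fun y hy x hx => ?_
    have hseg : segment ℝ x y ⊆ interior Ω := hconv.interior.segment_subset hx hy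
    have hsc : IsCompact (segment ℝ x y) := by
      rw [segment_eq_image]
      exact isCompact_Icc.image (by fun_prop)
    obtain ⟨δ, hδ, hth⟩ := hsc.exists_cthickening_subset_open isOpen_interior hseg
    have hball : ∀ z ∈ segment ℝ x y, Metric.closedBall z δ ⊆ interior Ω := fun z hz =>
      (Metric.closedBall_subset_cthickening hz δ).trans hth
    set v := φ y - φ x with hv
    let η : ℕ → ContDiffBump (0 : Euc d) := fun n =>
      ⟨1 / ((n : ℝ) + 1) / 2, 1 / ((n : ℝ) + 1), by positivity, half_lt_self (by positivity)⟩
    have hη : Tendsto (fun n => (η n).rOut) atTop (𝓝 0) := tendsto_one_div_add_atTop_nhds_zero_nat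
    have hm : AEStronglyMeasurable (Ω.indicator fun w => ⟪φ w, v⟫) volume := by
      rw [aestronglyMeasurable_indicator_iff hΩ.measurableSet]
      exact (hφ.1.inner continuousOn_const).aestronglyMeasurable hΩ.measurableSet
    have ht : ∀ z ∈ interior Ω, Tendsto (fun n => (convolution ((η n).normed volume)
        (Ω.indicator fun w => ⟪φ w, v⟫) (ContinuousLinearMap.lsmul ℝ ℝ) volume) z) atTop
        (𝓝 ⟪φ z, v⟫) := by
      intro z hz
      refine ContDiffBump.convolution_tendsto_right hη (Eventually.of_forall fun _ => hm) ?_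
        tendsto_const_nhds
      have hn : Ω ∈ 𝓝 z := mem_interior_iff_mem_nhds.1 hz
      have h1 : Tendsto (Ω.indicator fun w => ⟪φ w, v⟫) (𝓝 z) (𝓝 ⟪φ z, v⟫) := by
        have : ContinuousAt (fun w => ⟪φ w, v⟫) z :=
          (hφ.1.continuousAt hn).inner continuousAt_const
        refine Tendsto.congr' ?_ this
        filter_upwards [hn] with w hw
        simp [hw]
      exact h1.comp tendsto_snd
    have hle : ‖⟪φ y, v⟫ - ⟪φ x, v⟫‖ ≤ ‖v‖ * ‖y - x‖ := by
      refine le_of_tendsto ((ht y hy).sub (ht x hx)).norm ?_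
      filter_upwards [hη.eventually (Iic_mem_nhds hδ)] with n hn
      exact bump_lip hΩ hφ v hball (η n) hn
    rw [← inner_sub_left, ← hv, real_inner_self_eq_norm_sq, Real.norm_of_nonneg (by positivity),
      sq] at hle
    rw [dist_eq_norm, dist_eq_norm, ← hv, NNReal.coe_one, one_mul]
    by_cases h0 : ‖v‖ = 0
    · rw [h0]; positivity
    · exact le_of_mul_le_mul_left hle (lt_of_le_of_ne (norm_nonneg _) (Ne.symm h0))
  have := LipschitzOnWith.closure (K := 1) (f := φ) (s := interior Ω) (by rw [hcl]; exact hφ.1) main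
  rwa [hcl] at this

lemma weak_limit {H : Type*} [NormedAddCommGroup H] [InnerProductSpace ℝ H] [CompleteSpace H]
    (U : Ultrafilter ℕ) (u : ℕ → H) (C : ℝ) (hu : ∀ n, ‖u n‖ ≤ C) :
    ∃ w : H, ∀ k : H, Tendsto (fun n => ⟪u n, k⟫) U (𝓝 ⟪w, k⟫) := by
  have hK := WeakDual.isCompact_closedBall (𝕜 := ℝ) (E := H) 0 C
  let F : ℕ → WeakDual ℝ H := fun n => StrongDual.toWeakDual (InnerProductSpace.toDual ℝ H (u n))
  obtain ⟨f, -, hf⟩ := hK.ultrafilter_le_nhds (U.map F) (by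
    rw [le_principal_iff]
    change ∀ᶠ n in (U : Filter ℕ), F n ∈ _
    refine Filter.Eventually.of_forall fun n => ?_
    simp only [Set.mem_preimage, mem_closedBall_zero_iff, F]
    simpa using hu n)
  refine ⟨(InnerProductSpace.toDual ℝ H).symm (WeakDual.toStrongDual f), fun k => ?_⟩
  have h1 : Tendsto F U (𝓝 f) := hf
  have h2 := ((WeakDual.eval_continuous k).tendsto f).comp h1
  rw [InnerProductSpace.toDual_symm_apply]
  exact h2

/-- Flattening of `V^d` to a Hilbert space. -/
def flatS : (Euc d →L[ℝ] V) →ₗ[ℝ] PiLp 2 (fun _ : Fin d => V) where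
  toFun A := WithLp.toLp 2 fun i => A (EuclideanSpace.single i 1)
  map_add' A B := by ext i; simp
  map_smul' c A := by ext i; simp

/-- Inverse of the flattening. -/
def flatT : PiLp 2 (fun _ : Fin d => V) →ₗ[ℝ] (Euc d →L[ℝ] V) where
  toFun a := ∑ i, (EuclideanSpace.proj i : Euc d →L[ℝ] ℝ).smulRight (a i)
  map_add' a b := by
    ext h; simp [sum_apply, Finset.sum_add_distrib]
  map_smul' c a := by
    ext h
    simp only [sum_apply, ContinuousLinearMap.smulRight_apply, PiLp.smul_apply, RingHom.id_apply,
      ContinuousLinearMap.smul_apply, Finset.smul_sum]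
    exact Finset.sum_congr rfl fun i _ => smul_comm _ _ _

lemma flatS_T (a : PiLp 2 (fun _ : Fin d => V)) : flatS (flatT a) = a := by
  ext i
  simp [flatS, flatT, sum_apply, Pi.single_apply]

lemma flatS_norm (A : Euc d →L[ℝ] V) : ‖flatS A‖ = frobNorm A := by
  rw [PiLp.norm_eq_of_L2]; rfl

lemma flatS_inner (A B : Euc d →L[ℝ] V) : ⟪flatS A, flatS B⟫ = frobInner A B := by
  rw [PiLp.inner_apply]; rfl

lemma grad_limit {Ω : Set (Euc d)} (hΩ : IsCompact Ω) (U : Ultrafilter ℕ)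
    (g : ℕ → Euc d → Euc d →L[ℝ] V)
    (hm : ∀ n, AEStronglyMeasurable (g n) (volume.restrict Ω))
    (hb : ∀ n, ∀ᵐ x ∂(volume.restrict Ω), frobNorm (g n x) ≤ 1) :
    ∃ g₀ : Euc d → Euc d →L[ℝ] V, AEStronglyMeasurable g₀ (volume.restrict Ω) ∧
      (∀ᵐ x ∂(volume.restrict Ω), frobNorm (g₀ x) ≤ 1) ∧
      ∀ ψ : Euc d → Euc d →L[ℝ] V, Continuous ψ → HasCompactSupport ψ →
        Tendsto (fun n => ∫ x in Ω, frobInner (g n x) (ψ x)) U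
          (𝓝 (∫ x in Ω, frobInner (g₀ x) (ψ x))) := by
  set m := (volume : Measure (Euc d)).restrict Ω with hmdef
  have : IsFiniteMeasure m := ⟨by rw [hmdef, Measure.restrict_apply_univ]; exact hΩ.measure_lt_top⟩
  have hScont : Continuous (flatS : (Euc d →L[ℝ] V) →ₗ[ℝ] _) :=
    LinearMap.continuous_of_finiteDimensional _
  have hTcont : Continuous (flatT : _ →ₗ[ℝ] (Euc d →L[ℝ] V)) :=
    LinearMap.continuous_of_finiteDimensional _
  have : CompleteSpace V := FiniteDimensional.complete ℝ V
  have hmem : ∀ n, MemLp (fun x => flatS (g n x)) 2 m := fun n =>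
    MemLp.of_bound (hScont.comp_aestronglyMeasurable (hm n)) 1 (by
      filter_upwards [hb n] with x hx
      rwa [flatS_norm])
  have hbd : ∀ n, ‖(hmem n).toLp‖ ≤ (m.real univ) ^ ((2 : ℝ≥0∞).toReal)⁻¹ * 1 := fun n =>
    Lp.norm_le_of_ae_bound (by norm_num) (by
      filter_upwards [(hmem n).coeFn_toLp, hb n] with x hx hx2
      rwa [hx, flatS_norm])
  obtain ⟨G, hG⟩ := weak_limit U _ _ hbd
  have hlim : ∀ k : Euc d → PiLp 2 (fun _ : Fin d => V), ∀ _ : MemLp k 2 m,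
      Tendsto (fun n => ∫ x, ⟪flatS (g n x), k x⟫ ∂m) U (𝓝 (∫ x, ⟪G x, k x⟫ ∂m)) := by
    intro k hk
    have := hG hk.toLp
    simp only [L2.inner_def] at this
    have e2 : ∫ x, ⟪G x, k x⟫ ∂m = ∫ x, ⟪G x, (hk.toLp k) x⟫ ∂m := by
      refine integral_congr_ae (μ := m) ?_
      filter_upwards [hk.coeFn_toLp] with x h2
      rw [h2]
    rw [e2]
    refine this.congr fun n => ?_
    refine integral_congr_ae (μ := m) ?_
    filter_upwards [(hmem n).coeFn_toLp, hk.coeFn_toLp] with x h1 h2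
    rw [h1, h2]
  refine ⟨fun x => flatT (G x), hTcont.comp_aestronglyMeasurable (Lp.aestronglyMeasurable G), ?_, ?_⟩
  · have hGm := Lp.stronglyMeasurable G
    set A : Set (Euc d) := {x | 1 < ‖G x‖} with hA
    have hAm : MeasurableSet A := measurableSet_lt measurable_const hGm.norm.measurable
    have hk : MemLp (A.indicator G) 2 m := (Lp.memLp G).indicator hAm
    have hk1 : Integrable (A.indicator G) m := hk.integrable (by norm_num)
    have hle : ∫ x, ⟪G x, A.indicator G x⟫ ∂m ≤ ∫ x, ‖A.indicator G x‖ ∂m := by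
      refine le_of_tendsto (hlim _ hk) (Eventually.of_forall fun n => ?_)
      refine (le_abs_self _).trans ?_
      rw [← Real.norm_eq_abs]
      refine norm_integral_le_of_norm_le hk1.norm ?_
      filter_upwards [hb n] with x hx
      refine (norm_inner_le_norm _ _).trans ?_
      rw [flatS_norm]
      exact mul_le_of_le_one_left (norm_nonneg _) hx
    have hi1 : Integrable (fun x => ⟪G x, A.indicator G x⟫) m := by
      refine (L2.integrable_inner (𝕜 := ℝ) G hk.toLp).congr ?_
      filter_upwards [hk.coeFn_toLp] with x h2
      rw [h2]
    have hpos : 0 ≤ fun x => ⟪G x, A.indicator G x⟫ - ‖A.indicator G x‖ := by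
      intro x
      by_cases hx : x ∈ A
      · have : 1 < ‖G x‖ := hx
        simp only [hx, Set.indicator_of_mem, real_inner_self_eq_norm_sq, Pi.zero_apply]
        nlinarith
      · simp [hx]
    have hz : ∫ x, (⟪G x, A.indicator G x⟫ - ‖A.indicator G x‖) ∂m = 0 := by
      refine le_antisymm ?_ (integral_nonneg hpos)
      rw [integral_sub hi1 hk1.norm]
      linarith
    rw [integral_eq_zero_iff_of_nonneg hpos (hi1.sub hk1.norm)] at hz
    filter_upwards [hz] with x hx
    rw [← flatS_norm, flatS_T]
    by_contra hcon
    have hxA : x ∈ A := not_le.1 hcon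
    have : 1 < ‖G x‖ := hxA
    simp only [hxA, Set.indicator_of_mem, real_inner_self_eq_norm_sq, Pi.zero_apply] at hx
    nlinarith
  · intro ψ hψ hψc
    have hk : MemLp (fun x => flatS (ψ x)) 2 m := by
      obtain ⟨C, hC⟩ := hψc.exists_bound_of_continuous hψ
      obtain ⟨C', hC'⟩ := (hψc.comp_left (g := flatS) (map_zero _)).exists_bound_of_continuous
        (hScont.comp hψ)
      exact MemLp.of_bound (hScont.comp hψ).aestronglyMeasurable C' (Eventually.of_forall hC')
    have := hlim _ hk
    simp only [flatS_inner] at this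
    convert this using 4 with x
    rw [← flatS_inner, flatS_T]

lemma pair_integrable {Ω : Set (Euc d)} (hΩ : IsCompact Ω) {φ : Euc d → V}
    (hc : ContinuousOn φ Ω) (ρ : Measure (Euc d)) (den : Euc d → V) (hρ : ρ Ωᶜ = 0)
    (hden : Integrable den ρ) : Integrable (fun x => ⟪φ x, den x⟫) ρ := by
  have hae : ∀ᵐ x ∂ρ, x ∈ Ω := hρ
  obtain ⟨C, hC⟩ := hΩ.exists_bound_of_continuousOn hc
  have hm : AEStronglyMeasurable φ ρ := by
    have := hc.aestronglyMeasurable (μ := ρ) hΩ.measurableSet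
    rwa [Measure.restrict_eq_self_of_ae_mem hae] at this
  refine (hden.norm.const_mul C).mono' (hm.inner hden.1) ?_
  filter_upwards [hae] with x hx
  exact (norm_inner_le_norm _ _).trans (mul_le_mul_of_nonneg_right (hC x hx) (norm_nonneg _))

lemma pair_tendsto {Ω : Set (Euc d)} (hΩ : IsCompact Ω) {U : Filter ℕ} {f : ℕ → Euc d → V}
    {φ : Euc d → V} (hf : ∀ n, ContinuousOn (f n) Ω) (hc : ContinuousOn φ Ω)
    (hu : TendstoUniformlyOn f φ U Ω)
    (ρ : Measure (Euc d)) (den : Euc d → V) (hρ : ρ Ωᶜ = 0)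
    (hden : Integrable den ρ) :
    Tendsto (fun n => ∫ x, ⟪f n x, den x⟫ ∂ρ) U (𝓝 (∫ x, ⟪φ x, den x⟫ ∂ρ)) := by
  have hae : ∀ᵐ x ∂ρ, x ∈ Ω := hρ
  rw [Metric.tendsto_nhds]
  intro ε hε
  set I := ∫ x, ‖den x‖ ∂ρ with hI
  have hI0 : 0 ≤ I := integral_nonneg fun _ => norm_nonneg _
  have hδ : 0 < ε / (I + 1) := by positivity
  filter_upwards [Metric.tendstoUniformlyOn_iff.1 hu _ hδ] with n hn
  rw [dist_eq_norm, ← integral_sub (pair_integrable hΩ (hf n) ρ den hρ hden)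
    (pair_integrable hΩ hc ρ den hρ hden)]
  calc _ ≤ ∫ x, ε / (I + 1) * ‖den x‖ ∂ρ := by
        refine norm_integral_le_of_norm_le (hden.norm.const_mul _) ?_
        filter_upwards [hae] with x hx
        rw [← inner_sub_left]
        refine (norm_inner_le_norm _ _).trans (mul_le_mul_of_nonneg_right ?_ (norm_nonneg _))
        rw [← dist_eq_norm, dist_comm]
        exact (hn x hx).le
    _ = ε / (I + 1) * I := by rw [integral_const_mul]
    _ < ε := by
        rw [div_mul_eq_mul_div, div_lt_iff₀ (by positivity)]
        nlinarith

lemma ultra_limit {Ω : Set (Euc d)} (hΩ : IsCompact Ω) (U : Ultrafilter ℕ) (f : ℕ → Euc d → V)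
    (hf : ∀ n, LipschitzOnWith 1 (f n) Ω) {x₀ : Euc d} (hx₀ : x₀ ∈ Ω) (h0 : ∀ n, f n x₀ = 0) :
    ∃ φ : Euc d → V, ContinuousOn φ Ω ∧ TendstoUniformlyOn f φ U Ω := by
  have hpt : ∀ x, ∃ v, x ∈ Ω → Tendsto (fun n => f n x) U (𝓝 v) := by
    intro x
    by_cases hx : x ∈ Ω
    · have : ProperSpace V := FiniteDimensional.proper ℝ V
      obtain ⟨v, -, hv⟩ := (isCompact_closedBall (0 : V) (dist x x₀)).ultrafilter_le_nhds
        (U.map fun n => f n x) (by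
          rw [le_principal_iff]
          change ∀ᶠ n in (U : Filter ℕ), f n x ∈ _
          refine Filter.Eventually.of_forall fun n => ?_
          have := (hf n).dist_le_mul x hx x₀ hx₀
          rw [h0 n] at this
          simpa using this)
      exact ⟨v, fun _ => hv⟩
    · exact ⟨0, fun h => absurd h hx⟩
  choose φ hφ using hpt
  have hlip : LipschitzOnWith 1 φ Ω := by
    refine LipschitzOnWith.of_dist_le_mul fun x hx y hy => ?_
    exact le_of_tendsto ((hφ x hx).dist (hφ y hy))
      (Eventually.of_forall fun n => (hf n).dist_le_mul x hx y hy)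
  refine ⟨φ, hlip.continuousOn, ?_⟩
  rw [Metric.tendstoUniformlyOn_iff]
  intro ε hε
  obtain ⟨t, htΩ, htf, hcov⟩ := hΩ.finite_cover_balls (e := ε / 4) (by positivity)
  have hev : ∀ᶠ n in (U : Filter ℕ), ∀ y ∈ t, dist (f n y) (φ y) < ε / 4 := by
    rw [Filter.eventually_all_finite htf]
    intro y hy
    exact Metric.tendsto_nhds.1 (hφ y (htΩ hy)) _ (by positivity)
  filter_upwards [hev] with n hn x hx
  obtain ⟨y, hy, hxy⟩ := Set.mem_iUnion₂.1 (hcov hx)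
  have hxy' : dist x y < ε / 4 := hxy
  have h1 := (hf n).dist_le_mul x hx y (htΩ hy)
  have h2 := hlip.dist_le_mul x hx y (htΩ hy)
  have h3 := hn y hy
  simp only [NNReal.coe_one, one_mul] at h1 h2
  have h4 := dist_triangle (φ x) (φ y) (f n x)
  have h5 := dist_triangle (φ y) (f n y) (f n x)
  rw [dist_comm (φ y) (f n y), dist_comm (f n y) (f n x)] at h5
  linarith

lemma divg_cont {ψ : Euc d → Euc d →L[ℝ] V} (hψ : ContDiff ℝ (⊤ : ℕ∞) ψ) :
    Continuous (divg ψ) := by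
  have := hψ.continuous_fderiv (by simp)
  unfold divg
  fun_prop

lemma divg_zero {ψ : Euc d → Euc d →L[ℝ] V} {x : Euc d} (hx : x ∉ tsupport ψ) :
    divg ψ x = 0 := by
  have : fderiv ℝ ψ x = 0 := by
    by_contra h
    exact hx (support_fderiv_subset ℝ h)
  simp [divg, this]

lemma divg_int {Ω : Set (Euc d)} {ψ : Euc d → Euc d →L[ℝ] V} (hψ : IsTest Ω ψ) :
    Integrable (divg ψ) volume :=
  (divg_cont hψ.1).integrable_of_hasCompactSupport
    (HasCompactSupport.intro hψ.2.1 fun _ hx => divg_zero hx)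

lemma divg_integral {Ω : Set (Euc d)} {ψ : Euc d → Euc d →L[ℝ] V} (hψ : IsTest Ω ψ) :
    ∫ x in Ω, divg ψ x = 0 := by
  rw [setIntegral_eq_integral_of_forall_compl_eq_zero fun x hx =>
    divg_zero fun h => hx (interior_subset (hψ.2.2 h))]
  have hcd := hψ.1.continuous_fderiv (by simp)
  have hd : ∀ v, Integrable (fun x => fderiv ℝ ψ x v) volume := fun v =>
    (show Continuous fun x => fderiv ℝ ψ x v by fun_prop).integrable_of_hasCompactSupport
      (hψ.2.1.fderiv_apply (𝕜 := ℝ) v)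
  have hz : ∀ v, ∫ x, fderiv ℝ ψ x v = 0 := by
    intro v
    have := integral_smul_fderiv_eq_neg_fderiv_smul_of_integrable (μ := volume) (𝕜 := ℝ)
      (f := fun _ : Euc d => (1 : ℝ)) (g := ψ) (v := v) (by simp) (by simpa using hd v)
      (by simpa using hψ.1.continuous.integrable_of_hasCompactSupport hψ.2.1)
      (fun x _ => by fun_prop) (fun x _ => hψ.1.differentiable (by simp) x)
    simpa using this
  unfold divg
  rw [integral_finsetSum _ fun i _ => (hd _).apply_continuousLinearMap _]
  refine Finset.sum_eq_zero fun i _ => ?_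
  rw [← ContinuousLinearMap.integral_apply (hd _), hz]
  rfl

lemma frlip_sub_const {Ω : Set (Euc d)} (hΩ : IsCompact Ω) {φ : Euc d → V} (hφ : FrLipOn 1 Ω φ)
    (c : V) : FrLipOn 1 Ω fun x => φ x - c := by
  obtain ⟨hc, g, hgm, hgb, hg⟩ := hφ
  refine ⟨hc.sub continuousOn_const, g, hgm, hgb, fun ψ hψ => ?_⟩
  rw [← hg ψ hψ]
  have hρ : (volume.restrict Ω) Ωᶜ = 0 := by
    rw [Measure.restrict_apply hΩ.measurableSet.compl]; simp
  have hdi := (divg_int hψ).restrict (s := Ω)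
  have : CompleteSpace V := FiniteDimensional.complete ℝ V
  simp only [inner_sub_left]
  rw [integral_sub (pair_integrable hΩ hc _ _ hρ hdi)
    (pair_integrable hΩ continuousOn_const _ _ hρ hdi), integral_inner hdi, divg_integral hψ]
  simp

lemma pair_sub_const {Ω : Set (Euc d)} (hΩ : IsCompact Ω) {φ : Euc d → V}
    (hφ : ContinuousOn φ Ω) (c : V) (μ : VMeas Ω V) :
    μ.pair (fun x => φ x - c) = μ.pair φ - ⟪c, μ.mass⟫ := by
  have : CompleteSpace V := FiniteDimensional.complete ℝ V
  unfold VMeas.pair VMeas.mass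
  simp only [inner_sub_left]
  rw [integral_sub (pair_integrable hΩ hφ _ _ μ.null_compl μ.integrable)
    (pair_integrable hΩ continuousOn_const _ _ μ.null_compl μ.integrable),
    integral_inner μ.integrable]

/-- Compactness of the normalized admissible set. -/
lemma frlip_compact {Ω : Set (Euc d)} (hΩ : IsCompact Ω) (hconv : Convex ℝ Ω)
    (hint : (interior Ω).Nonempty) (U : Ultrafilter ℕ) (f : ℕ → Euc d → V)
    (hf : ∀ n, FrLipOn 1 Ω (f n)) {x₀ : Euc d} (hx₀ : x₀ ∈ Ω) (h0 : ∀ n, f n x₀ = 0) :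
    ∃ φ, FrLipOn 1 Ω φ ∧ TendstoUniformlyOn f φ U Ω := by
  obtain ⟨φ, hc, hu⟩ := ultra_limit hΩ U f (fun n => frlip_lip hΩ hconv hint (hf n)) hx₀ h0
  choose hfc g hgm hgb hg using hf
  obtain ⟨g₀, hm, hb, hlim⟩ := grad_limit hΩ U g hgm hgb
  refine ⟨φ, ⟨hc, g₀, hm, hb, fun ψ hψ => ?_⟩, hu⟩
  have hρ : (volume.restrict Ω) Ωᶜ = 0 := by
    rw [Measure.restrict_apply hΩ.measurableSet.compl]; simp
  have h1 := pair_tendsto hΩ hfc hc hu (volume.restrict Ω) (divg ψ) hρ (divg_int hψ).restrict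
  have h2 := (hlim ψ hψ.1.continuous hψ.2.1).neg
  simp only [hg _ ψ hψ] at h1
  exact tendsto_nhds_unique h1 h2

/-- for `μ, ν ∈ M(Ω;V)` with the same total mass, the dual problem
`sup { ∫_Ω ⟨φ, ν-μ⟩_V : φ ∈ C(Ω;V), |∇φ|_{V^d,∞} ≤ 1 }` is attained by some
`φ ∈ Fr-Lip(Ω,V)`. -/
theorem dual_problem_attained
    (Ω : Set (Euc d)) (hΩcomp : IsCompact Ω) (hΩconv : Convex ℝ Ω)
    (hΩint : (interior Ω).Nonempty)
    (μ ν : VMeas Ω V) (hmass : μ.mass = ν.mass) :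
    ∃ φ₀ : Euc d → V, FrLipOn 1 Ω φ₀ ∧
      ∀ φ : Euc d → V, FrLipOn 1 Ω φ →
        ν.pair φ - μ.pair φ ≤ ν.pair φ₀ - μ.pair φ₀ := by
  classical
  obtain ⟨x₀, hx₀⟩ := hΩint
  have hx : x₀ ∈ Ω := interior_subset hx₀
  have hint : (interior Ω).Nonempty := ⟨x₀, hx₀⟩
  let D : (Euc d → V) → ℝ := fun φ => ν.pair φ - μ.pair φ
  have hDc : ∀ φ : Euc d → V, FrLipOn 1 Ω φ → D (fun x => φ x - φ x₀) = D φ := by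
    intro φ hφ
    simp only [D]
    rw [pair_sub_const hΩcomp hφ.1, pair_sub_const hΩcomp hφ.1, hmass]
    ring
  have hconvg : ∀ f : ℕ → Euc d → V, (∀ n, FrLipOn 1 Ω (f n)) →
      ∃ φ, FrLipOn 1 Ω φ ∧ Tendsto (fun n => D (f n)) (hyperfilter ℕ) (𝓝 (D φ)) := by
    intro f hf
    obtain ⟨φ, hφ, hu⟩ := frlip_compact hΩcomp hΩconv hint (hyperfilter ℕ)
      (fun n x => f n x - f n x₀) (fun n => frlip_sub_const hΩcomp (hf n) _) hx (by simp)
    refine ⟨φ, hφ, ?_⟩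
    have hcn : ∀ n, ContinuousOn (fun x => f n x - f n x₀) Ω := fun n =>
      (hf n).1.sub continuousOn_const
    have h1 := (pair_tendsto hΩcomp hcn hφ.1 hu ν.ρ ν.den ν.null_compl ν.integrable).sub
      (pair_tendsto hΩcomp hcn hφ.1 hu μ.ρ μ.den μ.null_compl μ.integrable)
    have h2 : (fun n => D (f n)) = fun n => D (fun x => f n x - f n x₀) :=
      funext fun n => (hDc _ (hf n)).symm
    rw [h2]
    exact h1
  let S : Set ℝ := D '' {φ | FrLipOn 1 Ω φ}
  have hne : S.Nonempty := by
    refine ⟨_, fun _ => 0, ⟨continuousOn_const, fun _ => 0, aestronglyMeasurable_const,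
      Eventually.of_forall fun x => ?_, fun ψ _ => ?_⟩, rfl⟩
    · simp [frobNorm]
    · simp [frobInner]
  have hbdd : BddAbove S := by
    by_contra hb
    rw [not_bddAbove_iff] at hb
    have : ∀ n : ℕ, ∃ φ : Euc d → V, FrLipOn 1 Ω φ ∧ (n : ℝ) < D φ := by
      intro n
      obtain ⟨_, ⟨φ, hφ, rfl⟩, hlt⟩ := hb n
      exact ⟨φ, hφ, hlt⟩
    choose f hf hlt using this
    obtain ⟨φ, -, ht⟩ := hconvg f hf
    have h1 : Tendsto (fun n => D (f n)) (hyperfilter ℕ) atTop :=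
      tendsto_atTop_mono (fun n => (hlt n).le)
        (tendsto_natCast_atTop_atTop.mono_left Nat.hyperfilter_le_atTop)
    exact not_tendsto_nhds_of_tendsto_atTop h1 _ ht
  obtain ⟨u, -, hu, huS⟩ := exists_seq_tendsto_sSup hne hbdd
  choose f hf hfu using huS
  obtain ⟨φ₀, hφ₀, ht⟩ := hconvg f hf
  have hD : D φ₀ = sSup S := by
    refine tendsto_nhds_unique ht ?_
    simp only [hfu]
    exact hu.mono_left Nat.hyperfilter_le_atTop
  refine ⟨φ₀, hφ₀, fun φ hφ => ?_⟩
  change D φ ≤ D φ₀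
  rw [hD]
  exact le_csSup hbdd ⟨φ, hφ, rfl⟩
end
end

section
/- Let Ω ⊂ ℝ^d be compact and convex with non-empty interior, V a real finite-dimensional inner product space, and μ, ν ∈ M(Ω;V) with the same total mass. Then the Beckmann problem inf{ ∫_Ω |σ|_{V^d} : σ ∈ M(Ω;V^d), div(σ) = μ−ν } admits a minimizer σ ∈ M(Ω;V^d). -/
open MeasureTheory Set Filter
open scoped ENNReal RealInnerProductSpace Topology

noncomputable section

variable {d : ℕ} {V : Type*} [NormedAddCommGroup V] [InnerProductSpace ℝ V]
  [FiniteDimensional ℝ V]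

set_option linter.unusedSectionVars false
set_option linter.style.haveILetI false

lemma bck_bdd {X : Type*} [TopologicalSpace X] [CompactSpace X] (f : C(X, ℝ)) :
    BddAbove (Set.range f) :=
  (isCompact_range f.continuous).bddAbove

section Abstract

variable {X : Type*} [TopologicalSpace X] [CompactSpace X] [T2Space X] [Nonempty X]
  [MeasurableSpace X] [BorelSpace X]

lemma bck_repr {P : Type*} [AddCommGroup P] [Module ℝ P] (G : P →ₗ[ℝ] C(X, ℝ))
    (L : P →ₗ[ℝ] ℝ) (C : ℝ) (hC : 0 ≤ C) (hL : ∀ p, L p ≤ C * ⨆ x, G p x) :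
    ∃ m : Measure X, IsFiniteMeasure m ∧ (∀ p, ∫ x, G p x ∂m = L p) ∧ m.real univ ≤ C := by
  have hker : L ∈ (LinearMap.ker G).dualAnnihilator := by
    rw [Submodule.mem_dualAnnihilator]
    intro p hp
    have h1 := hL p
    have h2 := hL (-p)
    have hp' : G p = 0 := hp
    simp [hp'] at h1 h2
    linarith
  rw [← LinearMap.range_dualMap_eq_dualAnnihilator_ker] at hker
  obtain ⟨L', hL'⟩ := hker
  have hL'' : ∀ p, L' (G p) = L p := fun p => by rw [← hL']; rfl
  obtain ⟨T, hT1, hT2⟩ := exists_extension_of_le_sublinear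
    (LinearMap.toPMap L' (LinearMap.range G)) (fun f => C * ⨆ x, f x)
    (by
      intro c hc f
      have : (⨆ x, (c • f) x) = c * ⨆ x, f x := by
        rw [Real.mul_iSup_of_nonneg hc.le]; rfl
      simp only [this]; ring)
    (by
      intro f g
      rw [← mul_add]
      refine mul_le_mul_of_nonneg_left ?_ hC
      exact ciSup_le fun x => add_le_add (le_ciSup (bck_bdd f) x) (le_ciSup (bck_bdd g) x))
    (by
      rintro ⟨_, p, rfl⟩
      exact (hL'' p).le.trans (hL p))
  have hTpos : ∀ f : C(X, ℝ), 0 ≤ f → 0 ≤ T f := by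
    intro f hf
    have h := hT2 (-f)
    have h' : (⨆ x, (-f) x) ≤ 0 := ciSup_le fun x => by
      have := hf x
      simpa using this
    rw [map_neg] at h
    nlinarith [mul_nonneg hC (neg_nonneg.2 h')]
  let Λ0 : CompactlySupportedContinuousMap X ℝ →ₗ[ℝ] ℝ :=
    { toFun := fun f => T f.toContinuousMap
      map_add' := fun f g => by rw [← map_add]; rfl
      map_smul' := fun c f => by rw [RingHom.id_apply, ← map_smul]; rfl }
  let Λ : CompactlySupportedContinuousMap X ℝ →ₚ[ℝ] ℝ :=
    PositiveLinearMap.mk₀ Λ0 (fun f hf => hTpos f.toContinuousMap hf)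
  have hΛ : ∀ f : C(X, ℝ), ∫ x, f x ∂(RealRMK.rieszMeasure Λ) = T f := fun f =>
    RealRMK.integral_rieszMeasure Λ (CompactlySupportedContinuousMap.continuousMapEquiv f)
  have hfin : IsFiniteMeasure (RealRMK.rieszMeasure Λ) := by
    refine ⟨?_⟩
    have := RealRMK.rieszMeasure_le_of_eq_one Λ
      (f := CompactlySupportedContinuousMap.continuousMapEquiv (1 : C(X, ℝ)))
      (fun x => zero_le_one) isCompact_univ (fun x _ => rfl)
    exact this.trans_lt ENNReal.ofReal_lt_top
  refine ⟨RealRMK.rieszMeasure Λ, hfin, fun p => ?_, ?_⟩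
  · rw [hΛ, ← hL'']
    exact hT1 ⟨G p, p, rfl⟩
  · have h1 := hΛ 1
    have h2 := hT2 1
    simp at h1 h2
    rw [h1]; exact h2

end Abstract

lemma frobNorm_nonneg (A : Euc d →L[ℝ] V) : 0 ≤ frobNorm A := Real.sqrt_nonneg _

lemma frobInner_self (A : Euc d →L[ℝ] V) : frobInner A A = frobNorm A ^ 2 := by
  unfold frobInner frobNorm
  rw [Real.sq_sqrt (Finset.sum_nonneg fun i _ => sq_nonneg _)]
  simp

lemma abs_frobInner_le (A B : Euc d →L[ℝ] V) :
    |frobInner A B| ≤ frobNorm A * frobNorm B := by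
  unfold frobInner frobNorm
  refine (Finset.abs_sum_le_sum_abs _ _).trans ?_
  refine (Finset.sum_le_sum fun i _ => abs_real_inner_le_norm _ _).trans ?_
  exact Real.sum_mul_le_sqrt_mul_sqrt _ _ _

lemma norm_le_frobNorm (A : Euc d →L[ℝ] V) : ‖A‖ ≤ frobNorm A := by
  refine A.opNorm_le_bound (frobNorm_nonneg A) fun x => ?_
  have hx : A x = ∑ i, x i • A (EuclideanSpace.single i 1) := by
    conv_lhs => rw [← (EuclideanSpace.basisFun (Fin d) ℝ).sum_repr x]
    simp
  rw [hx, mul_comm, EuclideanSpace.norm_eq]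
  refine (norm_sum_le _ _).trans ?_
  simp_rw [norm_smul]
  exact Real.sum_mul_le_sqrt_mul_sqrt _ _ _

lemma frobNorm_le_norm (A : Euc d →L[ℝ] V) : frobNorm A ≤ Real.sqrt d * ‖A‖ := by
  unfold frobNorm
  have : ∑ i : Fin d, ‖A (EuclideanSpace.single i 1)‖ ^ 2 ≤ d * ‖A‖ ^ 2 := by
    calc _ ≤ ∑ i : Fin d, ‖A‖ ^ 2 := by
          refine Finset.sum_le_sum fun i _ => ?_
          have := A.le_opNorm (EuclideanSpace.single i 1)
          simp at this
          gcongr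
      _ = _ := by simp
  refine (Real.sqrt_le_sqrt this).trans ?_
  rw [Real.sqrt_mul (by positivity), Real.sqrt_sq (norm_nonneg _)]

lemma continuous_frobNorm : Continuous (frobNorm : (Euc d →L[ℝ] V) → ℝ) := by
  unfold frobNorm; fun_prop

lemma continuous_frobInner :
    Continuous (fun p : (Euc d →L[ℝ] V) × (Euc d →L[ℝ] V) => frobInner p.1 p.2) := by
  unfold frobInner; fun_prop

lemma frobInner_add_left (A A' B : Euc d →L[ℝ] V) :
    frobInner (A + A') B = frobInner A B + frobInner A' B := by
  simp [frobInner, inner_add_left, Finset.sum_add_distrib]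

lemma frobInner_smul_left (c : ℝ) (A B : Euc d →L[ℝ] V) :
    frobInner (c • A) B = c * frobInner A B := by
  simp [frobInner, inner_smul_left, Finset.mul_sum]

lemma frobInner_comm (A B : Euc d →L[ℝ] V) : frobInner A B = frobInner B A := by
  simp [frobInner, real_inner_comm]

/-- the Frobenius pairing with a fixed matrix, as a continuous linear map -/
def frobCLM (A : Euc d →L[ℝ] V) : (Euc d →L[ℝ] V) →L[ℝ] ℝ where
  toFun B := frobInner A B
  map_add' B B' := by
    rw [frobInner_comm, frobInner_add_left, frobInner_comm B, frobInner_comm B']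
  map_smul' c B := by
    rw [frobInner_comm, frobInner_smul_left, frobInner_comm B]; rfl
  cont := continuous_frobInner.comp (Continuous.prodMk continuous_const continuous_id)

/-- the Frobenius unit ball -/
def frobBall (d : ℕ) (V : Type*) [NormedAddCommGroup V] [InnerProductSpace ℝ V] :
    Set (Euc d →L[ℝ] V) := {B | frobNorm B ≤ 1}

lemma isCompact_frobBall : IsCompact (frobBall d V) := by
  refine Metric.isCompact_of_isClosed_isBounded ?_ ?_
  · exact isClosed_le continuous_frobNorm continuous_const
  · refine (Metric.isBounded_closedBall (x := (0 : Euc d →L[ℝ] V)) (r := 1)).subset ?_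
    intro B hB
    simpa using (norm_le_frobNorm B).trans hB

lemma zero_mem_frobBall : (0 : Euc d →L[ℝ] V) ∈ frobBall d V := by
  simp [frobBall, frobNorm]

/-- C¹ functions -/
def C1Sub (d : ℕ) (V : Type*) [NormedAddCommGroup V] [InnerProductSpace ℝ V] :
    Submodule ℝ (Euc d → V) where
  carrier := {φ | ContDiff ℝ 1 φ}
  add_mem' {f g} h h' := ContDiff.add (f := f) (g := g) (n := 1) (𝕜 := ℝ) h h'
  zero_mem' := contDiff_const (c := (0 : V)) (n := 1) (𝕜 := ℝ) (E := Euc d)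
  smul_mem' c f h := ContDiff.const_smul (n := 1) (𝕜 := ℝ) (f := f) c h

lemma C1Sub.cd (φ : C1Sub d V) : ContDiff ℝ 1 φ.1 := φ.2

/-- gradient map -/
def gradMap (Ω : Set (Euc d)) : C1Sub d V →ₗ[ℝ] C(Ω × frobBall d V, ℝ) where
  toFun φ := ⟨fun p => frobInner (fderiv ℝ φ.1 p.1) p.2.1, by
    have h : Continuous (fderiv ℝ φ.1) := ContDiff.continuous_fderiv (C1Sub.cd φ) (by simp)
    exact continuous_frobInner.comp (((h.comp continuous_subtype_val).comp continuous_fst).prodMk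
        (continuous_subtype_val.comp continuous_snd))⟩
  map_add' φ φ' := by
    ext p
    have h : DifferentiableAt ℝ φ.1 p.1 := (ContDiff.differentiable (C1Sub.cd φ) (by simp)) _
    have h' : DifferentiableAt ℝ φ'.1 p.1 := (ContDiff.differentiable (C1Sub.cd φ') (by simp)) _
    simp [fderiv_add h h', frobInner_add_left]
  map_smul' c φ := by
    ext p
    have h : DifferentiableAt ℝ φ.1 p.1 := (ContDiff.differentiable (C1Sub.cd φ) (by simp)) _
    simp [fderiv_const_smul h, frobInner_smul_left]

lemma VMeas.ae_mem {W : Type*} [NormedAddCommGroup W] {Ω : Set (Euc d)} (μ : VMeas Ω W) :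
    ∀ᵐ x ∂μ.ρ, x ∈ Ω := by
  rw [ae_iff]; exact μ.null_compl

lemma VMeas.integrable_inner {Ω : Set (Euc d)} (hΩ : IsCompact Ω) (μ : VMeas Ω V)
    {φ : Euc d → V} (hφ : Continuous φ) : Integrable (fun x => ⟪φ x, μ.den x⟫) μ.ρ := by
  obtain ⟨M, hM⟩ := hΩ.exists_bound_of_continuousOn hφ.continuousOn
  refine (μ.integrable.norm.const_mul M).mono'
    (hφ.aestronglyMeasurable.inner μ.integrable.aestronglyMeasurable) ?_
  filter_upwards [μ.ae_mem] with x hx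
  exact (norm_inner_le_norm _ _).trans (mul_le_mul_of_nonneg_right (hM x hx) (norm_nonneg _))

/-- pairing as a linear map on C¹ functions -/
def VMeas.pairL {Ω : Set (Euc d)} (hΩ : IsCompact Ω) (μ : VMeas Ω V) : C1Sub d V →ₗ[ℝ] ℝ where
  toFun φ := μ.pair φ.1
  map_add' φ φ' := by
    have h := μ.integrable_inner hΩ (ContDiff.continuous (C1Sub.cd φ))
    have h' := μ.integrable_inner hΩ (ContDiff.continuous (C1Sub.cd φ'))
    simp only [VMeas.pair]
    rw [← integral_add h h']
    simp [inner_add_left]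
  map_smul' c φ := by
    simp only [VMeas.pair]
    simp [inner_smul_left, integral_const_mul]

lemma VMeas.pair_sub_mass {Ω : Set (Euc d)} (hΩ : IsCompact Ω) (μ : VMeas Ω V)
    {φ : Euc d → V} (hφ : Continuous φ) (v : V) :
    μ.pair φ = ⟪v, μ.mass⟫ + ∫ x, ⟪φ x - v, μ.den x⟫ ∂μ.ρ := by
  have h1 := μ.integrable_inner hΩ (φ := fun _ => v) continuous_const
  have h2 := μ.integrable_inner hΩ (φ := fun x => φ x - v) (by fun_prop)
  have h3 : ⟪v, μ.mass⟫ = ∫ x, ⟪v, μ.den x⟫ ∂μ.ρ := by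
    rw [VMeas.mass]; exact (integral_inner μ.integrable v).symm
  rw [h3, ← integral_add h1 h2, VMeas.pair]
  simp [inner_sub_left]

lemma VMeas.abs_pair_le {Ω : Set (Euc d)} (μ : VMeas Ω V)
    {φ : Euc d → V} (M : ℝ) (hM : ∀ x ∈ Ω, ‖φ x‖ ≤ M) :
    |∫ x, ⟪φ x, μ.den x⟫ ∂μ.ρ| ≤ M * μ.tv := by
  rw [VMeas.tv, ← integral_const_mul]
  rw [← Real.norm_eq_abs]
  refine norm_integral_le_of_norm_le (μ.integrable.norm.const_mul M) ?_
  filter_upwards [μ.ae_mem] with x hx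
  exact (norm_inner_le_norm _ _).trans (mul_le_mul_of_nonneg_right (hM x hx) (norm_nonneg _))

lemma VMeas.tv_nonneg {Ω : Set (Euc d)} (μ : VMeas Ω V) : 0 ≤ μ.tv :=
  integral_nonneg fun _ => norm_nonneg _

lemma VMeas.integrable_frobNorm {Ω : Set (Euc d)} (σ : VMeas Ω (Euc d →L[ℝ] V)) :
    Integrable (fun x => frobNorm (σ.den x)) σ.ρ := by
  refine (σ.integrable.norm.const_mul (Real.sqrt d)).mono'
    (continuous_frobNorm.comp_aestronglyMeasurable σ.integrable.aestronglyMeasurable) ?_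
  refine Eventually.of_forall fun x => ?_
  rw [Real.norm_of_nonneg (frobNorm_nonneg _)]
  exact frobNorm_le_norm _

lemma VMeas.abs_fpair_le {Ω : Set (Euc d)} (σ : VMeas Ω (Euc d →L[ℝ] V))
    {ψ : Euc d → Euc d →L[ℝ] V} (M : ℝ) (hM : ∀ x ∈ Ω, frobNorm (ψ x) ≤ M) :
    |σ.fpair ψ| ≤ M * σ.ftv := by
  rw [VMeas.ftv, ← integral_const_mul, ← Real.norm_eq_abs, VMeas.fpair]
  refine norm_integral_le_of_norm_le (σ.integrable_frobNorm.const_mul M) ?_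
  filter_upwards [σ.ae_mem] with x hx
  exact (abs_frobInner_le _ _).trans
    (mul_le_mul_of_nonneg_right (hM x hx) (frobNorm_nonneg _))

lemma frobNorm_fderiv_le {Ω : Set (Euc d)} (hΩ : IsCompact Ω) (φ : C1Sub d V) :
    ∀ x ∈ Ω, frobNorm (fderiv ℝ φ.1 x) ≤ ⨆ p, gradMap Ω φ p := by
  intro x hx
  haveI : CompactSpace Ω := isCompact_iff_compactSpace.1 hΩ
  haveI : CompactSpace (frobBall d V) := isCompact_iff_compactSpace.1 isCompact_frobBall
  have key : ∀ B : Euc d →L[ℝ] V, frobNorm B ≤ 1 →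
      frobInner (fderiv ℝ φ.1 x) B ≤ ⨆ p, gradMap Ω φ p := fun B hB =>
    le_ciSup (bck_bdd (gradMap Ω φ)) (⟨x, hx⟩, ⟨B, hB⟩)
  set A := fderiv ℝ φ.1 x
  rcases (frobNorm_nonneg A).eq_or_lt with h | h
  · rw [← h]
    have := key 0 zero_mem_frobBall
    simpa [frobInner] using this
  · have h1 : frobInner A ((frobNorm A)⁻¹ • A) = frobNorm A := by
      rw [frobInner_comm, frobInner_smul_left, frobInner_self]
      field_simp
    have h2 : frobNorm ((frobNorm A)⁻¹ • A) ≤ 1 := by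
      have h3 : frobNorm ((frobNorm A)⁻¹ • A) ^ 2 = 1 := by
        rw [← frobInner_self, frobInner_smul_left, h1]
        field_simp
      nlinarith [frobNorm_nonneg ((frobNorm A)⁻¹ • A)]
    have := key _ h2
    rwa [h1] at this

/-- Disintegration: a measure on `Ω × ball` gives a vector measure. -/
lemma exists_vmeas {Ω : Set (Euc d)} (hΩ : IsCompact Ω)
    (m : Measure (Ω × frobBall d V)) [IsFiniteMeasure m] :
    ∃ σ : VMeas Ω (Euc d →L[ℝ] V),
      (∀ ψ : Euc d → Euc d →L[ℝ] V, Continuous ψ →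
        σ.fpair ψ = ∫ p, frobInner (ψ p.1) p.2.1 ∂m) ∧ σ.ftv ≤ m.real univ := by
  haveI : CompactSpace Ω := isCompact_iff_compactSpace.1 hΩ
  haveI : CompactSpace (frobBall d V) := isCompact_iff_compactSpace.1 isCompact_frobBall
  haveI : Nonempty (frobBall d V) := ⟨⟨0, zero_mem_frobBall⟩⟩
  have hemb : MeasurableEmbedding (Subtype.val : Ω → Euc d) :=
    MeasurableEmbedding.subtype_coe hΩ.measurableSet
  let den0 : Ω → (Euc d →L[ℝ] V) := fun x => ∫ b, b.1 ∂(m.condKernel x)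
  have hbint : ∀ x, Integrable (fun b : frobBall d V => b.1) (m.condKernel x) := by
    intro x
    refine Integrable.of_bound (C := 1) continuous_subtype_val.aestronglyMeasurable ?_
    exact Eventually.of_forall fun b => (norm_le_frobNorm _).trans b.2
  have hinner : ∀ (A : Euc d →L[ℝ] V) x,
      frobInner A (den0 x) = ∫ b, frobInner A b.1 ∂(m.condKernel x) := fun A x =>
    ((frobCLM A).integral_comp_comm (hbint x)).symm
  have hden1 : ∀ x, frobNorm (den0 x) ≤ 1 := by
    intro x
    have h1 : frobInner (den0 x) (den0 x) ≤ frobNorm (den0 x) := by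
      rw [hinner]
      calc _ ≤ ∫ b : frobBall d V, frobNorm (den0 x) ∂(m.condKernel x) := by
            refine integral_mono ((frobCLM (den0 x)).integrable_comp (hbint x))
              (integrable_const _) fun b => ?_
            refine (le_abs_self _).trans ((abs_frobInner_le _ _).trans ?_)
            exact mul_le_of_le_one_right (frobNorm_nonneg _) b.2
        _ = _ := by simp
    rw [frobInner_self] at h1
    by_contra! h
    nlinarith
  have hmeas : StronglyMeasurable den0 :=
    StronglyMeasurable.integral_kernel continuous_subtype_val.stronglyMeasurable
  have hint : Integrable den0 m.fst :=
    Integrable.of_bound (C := 1) hmeas.aestronglyMeasurable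
      (Eventually.of_forall fun x => (norm_le_frobNorm _).trans (hden1 x))
  have hext : ∀ x : Ω, Function.extend Subtype.val den0 0 x.1 = den0 x := fun x =>
    Subtype.val_injective.extend_apply _ _ _
  refine ⟨⟨m.fst.map Subtype.val, Function.extend Subtype.val den0 0, ?_, ?_⟩, ?_, ?_⟩
  · rw [hemb.map_apply]; simp
  · rw [hemb.integrable_map_iff]
    have he : Function.extend Subtype.val den0 0 ∘ (Subtype.val : Ω → Euc d) = den0 :=
      funext hext
    rw [he]; exact hint
  · intro ψ hψ
    simp only [VMeas.fpair]
    rw [hemb.integral_map]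
    simp_rw [hext, hinner]
    refine Measure.integral_condKernel (f := fun p : Ω × frobBall d V =>
      frobInner (ψ p.1) p.2.1) ?_
    have hc : Continuous (fun p : Ω × frobBall d V => frobInner (ψ p.1) p.2.1) :=
      continuous_frobInner.comp (((hψ.comp continuous_subtype_val).comp continuous_fst).prodMk
        (continuous_subtype_val.comp continuous_snd))
    exact hc.integrable_of_hasCompactSupport (HasCompactSupport.of_compactSpace _)
  · simp only [VMeas.ftv]
    rw [hemb.integral_map]
    simp_rw [hext]
    calc _ ≤ ∫ x : Ω, (1 : ℝ) ∂m.fst := by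
          refine integral_mono_of_nonneg (Eventually.of_forall fun x => frobNorm_nonneg _)
            (integrable_const _) (Eventually.of_forall fun x => hden1 x)
      _ = _ := by simp [Measure.real, Measure.fst_univ]

/-- for `μ, ν ∈ M(Ω;V)` with the same total mass, the Beckmann
problem `inf { ∫_Ω |σ|_{V^d} : σ ∈ M(Ω;V^d), div σ = μ - ν }` admits a
minimizer. -/
theorem beckmann_attained
    (Ω : Set (Euc d)) (hΩcomp : IsCompact Ω) (hΩconv : Convex ℝ Ω)
    (hΩint : (interior Ω).Nonempty)
    (μ ν : VMeas Ω V) (hmass : μ.mass = ν.mass) :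
    ∃ σ₀ : VMeas Ω (Euc d →L[ℝ] V),
      DivEq σ₀ (fun φ => μ.pair φ - ν.pair φ) ∧
      ∀ σ : VMeas Ω (Euc d →L[ℝ] V),
        DivEq σ (fun φ => μ.pair φ - ν.pair φ) → σ₀.ftv ≤ σ.ftv := by
  haveI : CompactSpace Ω := isCompact_iff_compactSpace.1 hΩcomp
  haveI : CompactSpace (frobBall d V) := isCompact_iff_compactSpace.1 isCompact_frobBall
  obtain ⟨x0, hx0'⟩ := hΩint
  have hx0 : x0 ∈ Ω := interior_subset hx0'
  haveI : Nonempty Ω := ⟨⟨x0, hx0⟩⟩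
  haveI : Nonempty (frobBall d V) := ⟨⟨0, zero_mem_frobBall⟩⟩
  obtain ⟨R, hR⟩ := hΩcomp.isBounded.subset_closedBall x0
  let L : C1Sub d V →ₗ[ℝ] ℝ := ν.pairL hΩcomp - μ.pairL hΩcomp
  have hLdef : ∀ φ : C1Sub d V, L φ = ν.pair φ.1 - μ.pair φ.1 := fun φ => rfl
  let S : Set ℝ := {c | 0 ≤ c ∧ ∀ φ, L φ ≤ c * ⨆ p, gradMap Ω φ p}
  have hS0 : ∀ φ : C1Sub d V, 0 ≤ ⨆ p, gradMap Ω φ p := fun φ =>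
    (frobNorm_nonneg _).trans (frobNorm_fderiv_le hΩcomp φ x0 hx0)
  have hR0 : 0 ≤ R := by
    have := hR hx0
    simpa using this
  have hSne : S.Nonempty := by
    refine ⟨R * (ν.tv + μ.tv), mul_nonneg hR0 (add_nonneg ν.tv_nonneg μ.tv_nonneg), fun φ => ?_⟩
    set s := ⨆ p, gradMap Ω φ p with hs
    have hb : ∀ x ∈ Ω, ‖φ.1 x - φ.1 x0‖ ≤ s * R := by
      intro x hx
      have h1 := Convex.norm_image_sub_le_of_norm_fderiv_le (𝕜 := ℝ) (f := φ.1) (C := s)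
        (fun y _ => (ContDiff.differentiable (C1Sub.cd φ) (by simp)) y)
        (fun y hy => (norm_le_frobNorm _).trans (frobNorm_fderiv_le hΩcomp φ y hy))
        hΩconv hx0 hx
      refine h1.trans (mul_le_mul_of_nonneg_left ?_ (hS0 φ))
      have := hR hx
      rwa [Metric.mem_closedBall, dist_eq_norm] at this
    have hc := ContDiff.continuous (C1Sub.cd φ)
    rw [hLdef, ν.pair_sub_mass hΩcomp hc (φ.1 x0), μ.pair_sub_mass hΩcomp hc (φ.1 x0), hmass]
    have h1 := abs_le.1 (ν.abs_pair_le (φ := fun x => φ.1 x - φ.1 x0) _ hb)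
    have h2 := abs_le.1 (μ.abs_pair_le (φ := fun x => φ.1 x - φ.1 x0) _ hb)
    linarith [h1.2, h2.1]
  have hSbdd : BddBelow S := ⟨0, fun c hc => hc.1⟩
  have hC0 : 0 ≤ sInf S := le_csInf hSne fun c hc => hc.1
  have hCL : ∀ φ, L φ ≤ sInf S * ⨆ p, gradMap Ω φ p := by
    intro φ
    rcases (hS0 φ).eq_or_lt with h | h
    · obtain ⟨c, hc⟩ := hSne
      have := hc.2 φ
      rw [← h] at this ⊢
      simpa using this
    · rw [← div_le_iff₀ h]
      refine le_csInf hSne fun c hc => ?_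
      rw [div_le_iff₀ h]
      exact hc.2 φ
  obtain ⟨m, hm, hm1, hm2⟩ := bck_repr (gradMap Ω) L (sInf S) hC0 hCL
  obtain ⟨σ₀, hσ1, hσ2⟩ := exists_vmeas hΩcomp m
  refine ⟨σ₀, fun φ hφ => ?_, fun σ hσ => ?_⟩
  · rw [hσ1 _ (hφ.continuous_fderiv (by simp))]
    have h := hm1 ⟨φ, hφ⟩
    rw [hLdef] at h
    have h' : ∫ p, frobInner (fderiv ℝ φ (p : Ω × frobBall d V).1) p.2.1 ∂m
      = ν.pair φ - μ.pair φ := h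
    rw [h']
    ring
  · refine (hσ2.trans hm2).trans (csInf_le hSbdd ⟨integral_nonneg fun _ => frobNorm_nonneg _, ?_⟩)
    intro φ
    have h := hσ φ.1 (C1Sub.cd φ)
    have h1 := abs_le.1 (σ.abs_fpair_le _ (frobNorm_fderiv_le hΩcomp φ))
    rw [hLdef]
    have h2 : ν.pair φ.1 - μ.pair φ.1 = σ.fpair fun x => fderiv ℝ φ.1 x := by
      simp only at h
      linarith
    rw [h2, mul_comm]
    exact h1.2
end
end

section
/- Let Ω ⊂ ℝ^d be compact and convex with non-empty interior, V a real finite-dimensional inner product space, and λ > 0. For all μ, ν ∈ M(Ω;V), the unbalanced problem T^λ_{1,1}(μ,ν) = inf{ W₁^V(μ+δ, ν) + λ ∫_Ω |δ|_V : δ ∈ M(Ω;V) } admits a minimizer δ ∈ M(Ω;V). -/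
open MeasureTheory Set Filter
open scoped ENNReal RealInnerProductSpace Topology

noncomputable section

variable {d : ℕ} {V : Type*} [NormedAddCommGroup V] [InnerProductSpace ℝ V]
  [FiniteDimensional ℝ V]

section Helpers
open ProbabilityTheory

theorem aux_aesm {Ω : Set (Euc d)} (hΩ : IsCompact Ω) {ρ : Measure (Euc d)}
    (h0 : ρ Ωᶜ = 0) {φ : Euc d → V} (hφ : ContinuousOn φ Ω) :
    AEStronglyMeasurable φ ρ := by
  have h : ρ.restrict Ω = ρ := Measure.restrict_eq_self_of_ae_mem (by
    rw [ae_iff]; exact h0)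
  rw [← h]
  exact hφ.aestronglyMeasurable_of_isCompact hΩ hΩ.measurableSet

theorem aux_to [MeasurableSpace V] [BorelSpace V] {Ω : Set (Euc d)} (hΩ : IsCompact Ω)
    (δ : VMeas Ω V) :
    ∃ m : FiniteMeasure (Ω × Metric.closedBall (0 : V) 1), (m.mass : ℝ) = δ.tv ∧
      ∀ φ : Euc d → V, ContinuousOn φ Ω →
        ∫ p, ⟪φ p.1, (p.2 : V)⟫ ∂(m : Measure (Ω × Metric.closedBall (0 : V) 1)) = δ.pair φ := by
  have h : δ.ρ.restrict Ω = δ.ρ := Measure.restrict_eq_self_of_ae_mem (by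
    rw [ae_iff]; exact δ.null_compl)
  set D : Euc d → V := δ.integrable.1.mk δ.den with hD
  have hDm : StronglyMeasurable D := δ.integrable.1.stronglyMeasurable_mk
  have hDe : δ.den =ᵐ[δ.ρ] D := δ.integrable.1.ae_eq_mk
  have hDi : Integrable D δ.ρ := δ.integrable.congr hDe
  set P : Measure Ω := δ.ρ.comap Subtype.val with hP
  have hint : ∀ f : Euc d → ℝ, ∫ x : Ω, f x ∂P = ∫ x, f x ∂δ.ρ := fun f => by
    rw [hP, integral_subtype_comap hΩ.measurableSet, h]
  let u : Ω → Metric.closedBall (0 : V) 1 := fun x => ⟨‖D x‖⁻¹ • D x, by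
    rw [mem_closedBall_zero_iff, norm_smul, norm_inv, norm_norm]
    exact inv_mul_le_one⟩
  have hDsub : Measurable fun x : Ω => D x := hDm.measurable.comp measurable_subtype_coe
  have hu : Measurable u := by
    refine Measurable.subtype_mk ?_
    exact hDsub.norm.inv.smul hDsub
  have hn : Measurable fun x : Ω => ‖D x‖₊ := hDsub.nnnorm
  let Q : Measure Ω := P.withDensity (fun x => (‖D x‖₊ : ℝ≥0∞))
  have hlin : ∫⁻ x : Ω, (‖D x‖₊ : ℝ≥0∞) ∂P < ∞ := by
    have h1 : ∫⁻ x : Ω, (‖D x‖₊ : ℝ≥0∞) ∂P = ∫⁻ x, ‖D x‖ₑ ∂δ.ρ := by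
      rw [hP]
      conv_rhs => rw [← h, ← map_comap_subtype_coe hΩ.measurableSet]
      rw [(MeasurableEmbedding.subtype_coe hΩ.measurableSet).lintegral_map]
      rfl
    rw [h1]
    exact hDi.2
  have : IsFiniteMeasure Q := isFiniteMeasure_withDensity hlin.ne
  have hmap : Measurable fun x : Ω => (x, u x) := measurable_id.prodMk hu
  have : IsFiniteMeasure (Q.map fun x : Ω => (x, u x)) := Measure.isFiniteMeasure_map _ _
  let m : FiniteMeasure (Ω × Metric.closedBall (0 : V) 1) := ⟨Q.map fun x : Ω => (x, u x), this⟩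
  have key : ∀ F : Ω × Metric.closedBall (0 : V) 1 → ℝ, Continuous F →
      ∫ p, F p ∂(m : Measure (Ω × Metric.closedBall (0 : V) 1)) =
        ∫ x : Ω, ‖D x‖ * F (x, u x) ∂P := by
    intro F hF
    change ∫ p, F p ∂(Q.map fun x : Ω => (x, u x)) = _
    rw [integral_map hmap.aemeasurable hF.measurable.aestronglyMeasurable]
    change ∫ x, F (x, u x) ∂(P.withDensity (fun x => (‖D x‖₊ : ℝ≥0∞))) = _
    rw [integral_withDensity_eq_integral_smul hn]
    rfl
  refine ⟨m, ?_, ?_⟩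
  · have := key (fun _ => 1) continuous_const
    rw [integral_const] at this
    simp only [mul_one, smul_eq_mul] at this
    have h2 : (m.mass : ℝ) = (m : Measure (Ω × Metric.closedBall (0 : V) 1)).real univ := rfl
    rw [h2, this, hint (fun x => ‖D x‖), VMeas.tv]
    exact integral_congr_ae (hDe.mono fun x hx => by simp only [hx])
  · intro φ hφ
    have hc : Continuous fun p : Ω × Metric.closedBall (0 : V) 1 => ⟪φ p.1, (p.2 : V)⟫ := by
      have h1 : Continuous fun x : Ω => φ x := continuousOn_iff_continuous_domRestrict.1 hφ
      exact (h1.comp continuous_fst).inner (continuous_subtype_val.comp continuous_snd)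
    rw [key _ hc, VMeas.pair]
    have h3 : ∀ x : Ω, ‖D x‖ * ⟪φ x, ((u x : Metric.closedBall (0 : V) 1) : V)⟫ = ⟪φ x, D x⟫ := by
      intro x
      change ‖D x‖ * ⟪φ x, ‖D x‖⁻¹ • D x⟫ = _
      rw [real_inner_smul_right]
      by_cases hx : D x = 0
      · simp [hx]
      · rw [mul_inv_cancel_left₀ (norm_ne_zero_iff.2 hx)]
    simp only [h3]
    rw [hint (fun x => ⟪φ x, D x⟫)]
    exact integral_congr_ae (hDe.mono fun x hx => by simp only [hx])

theorem aux_from [MeasurableSpace V] [BorelSpace V] {Ω : Set (Euc d)} (hΩ : IsCompact Ω)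
    (m : FiniteMeasure (Ω × Metric.closedBall (0 : V) 1)) :
    ∃ δ : VMeas Ω V, δ.tv ≤ (m.mass : ℝ) ∧
      ∀ φ : Euc d → V, ContinuousOn φ Ω →
        ∫ p, ⟪φ p.1, (p.2 : V)⟫ ∂(m : Measure (Ω × Metric.closedBall (0 : V) 1)) = δ.pair φ := by
  let B := Metric.closedBall (0 : V) 1
  let M : Measure (Ω × B) := m
  let j : Ω × B → Euc d × V := fun p => (p.1, p.2)
  have hj : Measurable j := by
    exact (measurable_subtype_coe.comp measurable_fst).prodMk
      (measurable_subtype_coe.comp measurable_snd)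
  let M' : Measure (Euc d × V) := M.map j
  have : IsFiniteMeasure M' := Measure.isFiniteMeasure_map _ _
  let κ := M'.condKernel
  have hdis : M'.fst ⊗ₘ κ = M' := M'.disintegrate κ
  have h0 : M'.fst Ωᶜ = 0 := by
    rw [Measure.fst_apply hΩ.measurableSet.compl,
      Measure.map_apply hj (measurable_fst hΩ.measurableSet.compl)]
    have : j ⁻¹' (Prod.fst ⁻¹' Ωᶜ) = ∅ := by
      ext p; simp [j]
    rw [this, measure_empty]
  have hv : Integrable (fun p : Euc d × V => p.2) M' := by
    rw [integrable_map_measure measurable_snd.aestronglyMeasurable hj.aemeasurable]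
    refine Integrable.of_bound (measurable_snd.comp hj).aestronglyMeasurable 1 ?_
    exact Eventually.of_forall fun p => mem_closedBall_zero_iff.1 p.2.2
  have hv' : Integrable (fun p : Euc d × V => p.2) (M'.fst ⊗ₘ κ) := by rwa [hdis]
  have hvk := (Measure.integrable_compProd_iff hv'.1).1 hv'
  have hden : Integrable (fun x => ∫ v, v ∂(κ x)) M'.fst := by
    have := hv'.integral_compProd
    simpa using this
  refine ⟨⟨M'.fst, fun x => ∫ v, v ∂(κ x), h0, hden⟩, ?_, ?_⟩
  · change ∫ x, ‖∫ v, v ∂(κ x)‖ ∂M'.fst ≤ _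
    calc ∫ x, ‖∫ v, v ∂(κ x)‖ ∂M'.fst ≤ ∫ x, ∫ v, ‖v‖ ∂(κ x) ∂M'.fst :=
          integral_mono hden.norm hvk.2 fun x => norm_integral_le_integral_norm _
      _ = ∫ p, ‖p.2‖ ∂(M'.fst ⊗ₘ κ) := (Measure.integral_compProd hv'.norm).symm
      _ = ∫ p, ‖p.2‖ ∂M' := by rw [hdis]
      _ = ∫ p, ‖(j p).2‖ ∂M :=
          integral_map hj.aemeasurable measurable_snd.norm.aestronglyMeasurable
      _ ≤ ∫ p, (1 : ℝ) ∂M := by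
          refine integral_mono ?_ (integrable_const _) fun p => mem_closedBall_zero_iff.1 p.2.2
          exact ((integrable_map_measure measurable_snd.aestronglyMeasurable
            hj.aemeasurable).1 hv).norm
      _ = m.mass := by
          rw [integral_const, smul_eq_mul, mul_one]; rfl
  · intro φ hφ
    have hm : AEStronglyMeasurable φ M'.fst := aux_aesm hΩ h0 hφ
    have hm1 : AEStronglyMeasurable (fun p : Euc d × V => ⟪φ p.1, p.2⟫) M' := by
      have : AEStronglyMeasurable (fun p : Euc d × V => φ p.1) M' :=
        hm.comp_measurable measurable_fst
      exact this.inner measurable_snd.aestronglyMeasurable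
    obtain ⟨C, hC⟩ := hΩ.exists_bound_of_continuousOn hφ
    have hi : Integrable (fun p : Euc d × V => ⟪φ p.1, p.2⟫) M' := by
      rw [integrable_map_measure hm1 hj.aemeasurable]
      refine Integrable.of_bound (hm1.comp_measurable hj) C ?_
      refine Eventually.of_forall fun p => ?_
      have h1 := hC p.1 p.1.2
      have h2 : ‖(p.2 : V)‖ ≤ 1 := mem_closedBall_zero_iff.1 p.2.2
      calc ‖⟪φ p.1, (p.2 : V)⟫‖ ≤ ‖φ p.1‖ * ‖(p.2 : V)‖ := norm_inner_le_norm _ _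
        _ ≤ ‖φ p.1‖ * 1 := by gcongr
        _ ≤ C := by linarith
    have hi' : Integrable (fun p : Euc d × V => ⟪φ p.1, p.2⟫) (M'.fst ⊗ₘ κ) := by rwa [hdis]
    calc ∫ p, ⟪φ p.1, (p.2 : V)⟫ ∂M = ∫ p, ⟪φ p.1, p.2⟫ ∂M' :=
          (integral_map hj.aemeasurable hm1).symm
      _ = ∫ p, ⟪φ p.1, p.2⟫ ∂(M'.fst ⊗ₘ κ) := by rw [hdis]
      _ = ∫ x, ∫ v, ⟪φ x, v⟫ ∂(κ x) ∂M'.fst := Measure.integral_compProd hi'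
      _ = ∫ x, ⟪φ x, ∫ v, v ∂(κ x)⟫ ∂M'.fst := by
          refine integral_congr_ae (hvk.1.mono fun x hx => ?_)
          exact integral_inner hx (φ x)

end Helpers

/-- for every `μ, ν ∈ M(Ω;V)` and `λ > 0`, the unbalanced
problem `T^λ_{1,1}(μ,ν) = inf { W₁^V(μ+δ, ν) + λ ∫_Ω |δ|_V : δ ∈ M(Ω;V) }`
admits a minimizer `δ ∈ M(Ω;V)`. -/
theorem unbalanced_T11_attained
    (Ω : Set (Euc d)) (hΩcomp : IsCompact Ω) (hΩconv : Convex ℝ Ω)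
    (hΩint : (interior Ω).Nonempty)
    (lam : ℝ) (hlam : 0 < lam) (μ ν : VMeas Ω V) :
    ∃ δ₀ : VMeas Ω V, ∀ δ : VMeas Ω V,
      W1fn Ω (fun φ => ν.pair φ - μ.pair φ - δ₀.pair φ) +
          ENNReal.ofReal (lam * δ₀.tv) ≤
        W1fn Ω (fun φ => ν.pair φ - μ.pair φ - δ.pair φ) +
          ENNReal.ofReal (lam * δ.tv) := by
  letI : MeasurableSpace V := borel V
  have : BorelSpace V := ⟨rfl⟩
  have : CompactSpace Ω := isCompact_iff_compactSpace.1 hΩcomp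
  have : CompactSpace (Metric.closedBall (0 : V) 1) :=
    isCompact_iff_compactSpace.1 (isCompact_closedBall _ _)
  by_cases hfin : ∃ δ₁ : VMeas Ω V, W1fn Ω (fun φ => ν.pair φ - μ.pair φ - δ₁.pair φ) +
          ENNReal.ofReal (lam * δ₁.tv) ≠ ∞
  swap
  · push Not at hfin
    exact ⟨μ, fun δ => by rw [hfin δ]; exact le_top⟩
  obtain ⟨δ₁, h₁⟩ := hfin
  set T := W1fn Ω (fun φ => ν.pair φ - μ.pair φ - δ₁.pair φ) +
          ENNReal.ofReal (lam * δ₁.tv) with hT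
  let C : ℝ := T.toReal / lam
  have hC0 : 0 ≤ C := div_nonneg ENNReal.toReal_nonneg hlam.le
  have hCT : ENNReal.ofReal (lam * C) = T := by
    rw [mul_div_cancel₀ _ hlam.ne', ENNReal.ofReal_toReal h₁]
  let I : FiniteMeasure (Ω × Metric.closedBall (0 : V) 1) → (Euc d → V) → ℝ := fun m φ =>
    ∫ p, ⟪φ p.1, (p.2 : V)⟫ ∂(m : Measure (Ω × Metric.closedBall (0 : V) 1))
  let G : FiniteMeasure (Ω × Metric.closedBall (0 : V) 1) → ℝ≥0∞ := fun m =>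
    W1fn Ω (fun φ => ν.pair φ - μ.pair φ - I m φ) + ENNReal.ofReal (lam * (m.mass : ℝ))
  have hG : LowerSemicontinuous G := by
    refine LowerSemicontinuous.add ?_ ?_
    · refine lowerSemicontinuous_biSup fun φ hφ => Continuous.lowerSemicontinuous ?_
      have hc : Continuous fun p : Ω × Metric.closedBall (0 : V) 1 => ⟪φ p.1, (p.2 : V)⟫ := by
        have h1 : Continuous fun x : Ω => φ x := continuousOn_iff_continuous_domRestrict.1 hφ.1
        exact (h1.comp continuous_fst).inner (continuous_subtype_val.comp continuous_snd)
      have := FiniteMeasure.continuous_integral_boundedContinuousFunction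
        (BoundedContinuousFunction.mkOfCompact ⟨_, hc⟩)
      exact ENNReal.continuous_ofReal.comp (continuous_const.sub this)
    · refine Continuous.lowerSemicontinuous ?_
      exact ENNReal.continuous_ofReal.comp (continuous_const.mul
        (NNReal.continuous_coe.comp FiniteMeasure.continuous_mass))
  have hcongr : ∀ (m : FiniteMeasure (Ω × Metric.closedBall (0 : V) 1)) (δ : VMeas Ω V),
      (∀ φ : Euc d → V, ContinuousOn φ Ω → I m φ = δ.pair φ) →
      W1fn Ω (fun φ => ν.pair φ - μ.pair φ - I m φ) =
        W1fn Ω (fun φ => ν.pair φ - μ.pair φ - δ.pair φ) := by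
    intro m δ h
    unfold W1fn
    refine iSup_congr fun φ => iSup_congr fun hφ => ?_
    simp only [h φ hφ.1]
  let S : Set (FiniteMeasure (Ω × Metric.closedBall (0 : V) 1)) := {m | m.mass ≤ C.toNNReal}
  have hS : IsCompact S := isCompact_setOfPred_finiteMeasure_le_of_compactSpace _ _
  have hmem : ∀ m : FiniteMeasure (Ω × Metric.closedBall (0 : V) 1), (m.mass : ℝ) ≤ C → m ∈ S :=
    fun m hm => by
      change m.mass ≤ C.toNNReal
      exact NNReal.le_toNNReal_of_coe_le hm
  obtain ⟨m₁, hm₁, hp₁⟩ := aux_to hΩcomp δ₁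
  have htv₁ : δ₁.tv ≤ C := by
    rw [le_div_iff₀ hlam, mul_comm]
    exact (ENNReal.ofReal_le_iff_le_toReal h₁).1 le_add_self
  have hm₁S : m₁ ∈ S := hmem _ (hm₁.trans_le htv₁)
  obtain ⟨m₀, -, hmin⟩ := hG.lowerSemicontinuousOn S |>.exists_isMinOn ⟨m₁, hm₁S⟩ hS
  obtain ⟨δ₀, ht₀, hp₀⟩ := aux_from hΩcomp m₀
  have hGδ : ∀ (m : FiniteMeasure (Ω × Metric.closedBall (0 : V) 1)) (δ : VMeas Ω V),
      (m.mass : ℝ) = δ.tv → (∀ φ : Euc d → V, ContinuousOn φ Ω → I m φ = δ.pair φ) →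
      G m = W1fn Ω (fun φ => ν.pair φ - μ.pair φ - δ.pair φ) + ENNReal.ofReal (lam * δ.tv) := by
    intro m δ h1 h2
    change _ + _ = _
    rw [hcongr m δ h2, h1]
  refine ⟨δ₀, fun δ => ?_⟩
  have hle : W1fn Ω (fun φ => ν.pair φ - μ.pair φ - δ₀.pair φ) +
          ENNReal.ofReal (lam * δ₀.tv) ≤ G m₀ := by
    change _ ≤ _ + _
    rw [hcongr m₀ δ₀ hp₀]
    gcongr
  refine hle.trans ?_
  by_cases hδ : δ.tv ≤ C
  · obtain ⟨m, hm, hp⟩ := aux_to hΩcomp δ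
    rw [← hGδ m δ hm hp]
    exact hmin (hmem m (hm.trans_le hδ))
  · calc G m₀ ≤ G m₁ := hmin hm₁S
      _ = T := hGδ m₁ δ₁ hm₁ hp₁
      _ = ENNReal.ofReal (lam * C) := hCT.symm
      _ ≤ ENNReal.ofReal (lam * δ.tv) := by
          push Not at hδ
          gcongr
      _ ≤ _ := le_add_self
end
end
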